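/- arXiv:1301.6799 — 2 statements merged into one kernel-verified Lean document; each statement's English description precedes it below -/
import Mathlib

section
/- RPO(μ,φ,𝒪) = 1 if and only if φ = ∅. (Proposition 2, item 3 of the paper.) -/
open scoped ENNReal Classical

/-- The probability of a set of runs under a PMF. -/
noncomputable def mOf {R : Type*} (μ : PMF R) (S : Set R) : ℝ≥0∞ :=
  ∑' ρ : S, μ ρ

/-- Liberal probabilistic opacity. -/
noncomputable def LPO {R Obs : Type*} (μ : PMF R) (φ : Set R) (O : R → Obs) : ℝ≥0∞ :=
  ∑' o : Obs, if O ⁻¹' {o} ⊆ φ then mOf μ (O ⁻¹' {o}) else 0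

/-- Liberal probabilistic symmetrical opacity. -/
noncomputable def LPSO {R Obs : Type*} (μ : PMF R) (φ : Set R) (O : R → Obs) : ℝ≥0∞ :=
  LPO μ φ O + LPO μ φᶜ O

/-- Restrictive probabilistic opacity. -/
noncomputable def RPO {R Obs : Type*} (μ : PMF R) (φ : Set R) (O : R → Obs) : ℝ≥0∞ :=
  (∑' o : Obs, (mOf μ (O ⁻¹' {o})) ^ 2 / mOf μ (φᶜ ∩ O ⁻¹' {o}))⁻¹

/-- Vulnerability of φ within the observation class of o. -/
noncomputable def Vul {R Obs : Type*} (μ : PMF R) (φ : Set R) (O : R → Obs) (o : Obs) : ℝ≥0∞ :=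
  max (mOf μ (φ ∩ O ⁻¹' {o})) (mOf μ (φᶜ ∩ O ⁻¹' {o})) / mOf μ (O ⁻¹' {o})

/-- Restrictive probabilistic symmetric opacity. -/
noncomputable def RPSO {R Obs : Type*} (μ : PMF R) (φ : Set R) (O : R → Obs) : ℝ≥0∞ :=
  (∑' o : Obs, mOf μ (O ⁻¹' {o}) *
    (if Vul μ φ O o = 1 then ⊤
     else ENNReal.ofReal (- Real.logb 2 ((1 - Vul μ φ O o).toReal))))⁻¹

/-- φ is opaque for the observation O. -/
def IsOpaque {R Obs : Type*} (φ : Set R) (O : R → Obs) : Prop :=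
  ∀ o : Obs, ¬ O ⁻¹' {o} ⊆ φ

/-- φ is symmetrically opaque for the observation O. -/
def IsSymOpaque {R Obs : Type*} (φ : Set R) (O : R → Obs) : Prop :=
  ∀ o : Obs, ¬ O ⁻¹' {o} ⊆ φ ∧ ¬ O ⁻¹' {o} ⊆ φᶜ

theorem mOf_ne_top {R : Type*} (μ : PMF R) (S : Set R) : mOf μ S ≠ ⊤ :=
  ne_top_of_le_ne_top μ.tsum_coe_ne_top
    (ENNReal.tsum_comp_le_tsum_of_injective Subtype.val_injective _)

theorem mOf_ne_zero {R : Type*} {μ : PMF R} (hsupp : ∀ ρ : R, μ ρ ≠ 0) {S : Set R}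
    (hS : S.Nonempty) : mOf μ S ≠ 0 := by
  obtain ⟨ρ, hρ⟩ := hS
  exact fun h => hsupp ρ (ENNReal.tsum_eq_zero.1 h ⟨ρ, hρ⟩)

theorem mOf_compl_inter_add_inter {R : Type*} (μ : PMF R) (φ S : Set R) :
    mOf μ (φᶜ ∩ S) + mOf μ (φ ∩ S) = mOf μ S := by
  have hdisj : Disjoint (φᶜ ∩ S) (φ ∩ S) :=
    disjoint_compl_left.mono Set.inter_subset_left Set.inter_subset_left
  have hunion : (φᶜ ∩ S) ∪ (φ ∩ S) = S := by
    rw [← Set.union_inter_distrib_right, Set.compl_union_self, Set.univ_inter]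
  have h := ENNReal.summable.tsum_union_disjoint (f := μ) hdisj ENNReal.summable
  rw [hunion] at h
  exact h.symm

theorem tsum_mOf_fiber {R Obs : Type*} (μ : PMF R) (O : R → Obs) :
    ∑' o : Obs, mOf μ (O ⁻¹' {o}) = 1 := by
  rw [← μ.tsum_coe]
  exact ENNReal.tsum_fiberwise μ O

/-- Proposition 2, item 3: RPO equals one iff φ is empty. -/
theorem rpo_eq_one_iff_empty {R Obs : Type*} [Countable R]
    (μ : PMF R) (φ : Set R) (O : R → Obs)
    (hsupp : ∀ ρ : R, μ ρ ≠ 0) (hsurj : Function.Surjective O) :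
    RPO μ φ O = 1 ↔ φ = ∅ := by
  have h_zero (o : Obs) : mOf μ (O ⁻¹' {o}) ≠ 0 := mOf_ne_zero hsupp (hsurj o)
  have h_top (o : Obs) : mOf μ (O ⁻¹' {o}) ≠ ⊤ := mOf_ne_top μ _
  have h_sq (o : Obs) : mOf μ (O ⁻¹' {o}) ^ 2 ≠ 0 := pow_ne_zero 2 (h_zero o)
  rw [RPO, ENNReal.inv_eq_one]
  constructor
  · intro h
    by_contra hne
    obtain ⟨ρ, hρ⟩ := Set.nonempty_iff_ne_empty.2 hne
    refine absurd h (ne_of_gt ?_)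
    rw [← tsum_mOf_fiber μ O]
    refine ENNReal.tsum_lt_tsum (i := O ρ) (by simp [tsum_mOf_fiber]) (fun o => ?_) ?_
    · rw [ENNReal.le_div_iff_mul_le (.inr (h_sq o)) (.inl (mOf_ne_top μ _)), sq]
      gcongr
      exact le_self_add.trans_eq (mOf_compl_inter_add_inter μ φ _)
    · rw [ENNReal.lt_div_iff_mul_lt (.inr (h_top _))
        (.inl (mOf_ne_top μ _)), sq]
      refine (ENNReal.mul_lt_mul_iff_right (h_zero _) (h_top _)).2 ?_
      conv_rhs => rw [← mOf_compl_inter_add_inter μ φ]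
      exact ENNReal.lt_add_right (mOf_ne_top μ _) (mOf_ne_zero hsupp ⟨ρ, hρ, rfl⟩)
  · rintro rfl
    rw [← tsum_mOf_fiber μ O]
    refine tsum_congr fun o => ?_
    rw [Set.compl_empty, Set.univ_inter, sq, ENNReal.mul_div_cancel_right (h_zero o) (h_top o)]
end

section
/- For the Crowds protocol distribution, the restrictive probabilistic symmetric opacity of the predicate 'user i₀ initiated the request' with respect to the observation of the detected user is: RPSO(μ,φ,𝒪) = 1 / ( log₂ n − log₂(n−c−1)/(n−c) ) when n ≤ 2·(c+1), and RPSO(μ,φ,𝒪) = 1 / ( log₂ n − log₂(c+1)/(n−c) ) when n > 2·(c+1). (Section 6.3 of the paper.) -/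
open scoped ENNReal Classical

theorem mOf_eq_ofReal_sum {R : Type*} [Fintype R] (μ : PMF R) (f : R → ℝ) (hf : ∀ ρ, 0 ≤ f ρ)
    (hμ : ∀ ρ, μ ρ = ENNReal.ofReal (f ρ)) (S : Set R) :
    mOf μ S = ENNReal.ofReal (∑ ρ, if ρ ∈ S then f ρ else 0) := by
  rw [mOf, tsum_subtype S μ, tsum_fintype, ENNReal.ofReal_sum_of_nonneg]
  · refine Finset.sum_congr rfl fun ρ _ => ?_
    by_cases h : ρ ∈ S <;> simp [h, hμ]
  · intro ρ _
    split_ifs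
    exacts [hf ρ, le_rfl]

/-- The unnormalised weight `c + 1` on the diagonal and `1` elsewhere. -/
noncomputable def crowdsWeight {H : Type*} (c : ℕ) (i j : H) : ℝ :=
  if i = j then (c : ℝ) + 1 else 1

theorem crowdsWeight_pos {H : Type*} (c : ℕ) (i j : H) : 0 < crowdsWeight c i j := by
  unfold crowdsWeight
  split_ifs <;> positivity

theorem sum_crowdsWeight {n c : ℕ} (hn : c ≤ n) (j : Fin (n - c)) :
    ∑ i, crowdsWeight c i j = n := by
  have h : ∀ i : Fin (n - c), crowdsWeight c i j = (if i = j then (c : ℝ) else 0) + 1 := by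
    intro i
    unfold crowdsWeight
    split_ifs <;> simp
  simp [h, Finset.sum_add_distrib, Nat.cast_sub hn]

section Crowds

variable {n c : ℕ} {μ : PMF (Fin (n - c) × Fin (n - c))}

theorem crowds_apply (hn : c + 2 ≤ n)
    (hμ : ∀ i j : Fin (n - c),
      μ (i, j) = (if i = j then ((c : ℝ≥0∞) + 1) else 1) /
        ((n : ℝ≥0∞) * ((n - c : ℕ) : ℝ≥0∞)))
    (p : Fin (n - c) × Fin (n - c)) :
    μ p = ENNReal.ofReal (crowdsWeight c p.1 p.2 / (n * (n - c : ℕ))) := by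
  obtain ⟨i, j⟩ := p
  have h₁ : (0 : ℝ) < n := by exact_mod_cast (by omega : 0 < n)
  have h₂ : (0 : ℝ) < (n - c : ℕ) := by exact_mod_cast (by omega : 0 < n - c)
  rw [hμ, ENNReal.ofReal_div_of_pos (by positivity), ENNReal.ofReal_mul h₁.le]
  unfold crowdsWeight
  split_ifs
  · rw [ENNReal.ofReal_add (by positivity) zero_le_one]
    simp
  · simp

theorem mOf_crowds_fibre (hn : c + 2 ≤ n)
    (hμ : ∀ p, μ p = ENNReal.ofReal (crowdsWeight c p.1 p.2 / (n * (n - c : ℕ))))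
    (o : Fin (n - c)) :
    mOf μ (Prod.snd ⁻¹' {o}) = ENNReal.ofReal (1 / (n - c : ℕ)) := by
  rw [mOf_eq_ofReal_sum μ _ (fun p => div_nonneg (crowdsWeight_pos c _ _).le (by positivity)) hμ,
    Fintype.sum_prod_type]
  have h₁ : (0 : ℝ) < n := by exact_mod_cast (by omega : 0 < n)
  simp only [Set.mem_preimage, Set.mem_singleton_iff, Finset.sum_ite_eq', Finset.mem_univ, if_true]
  rw [← Finset.sum_div, sum_crowdsWeight (by omega)]
  congr 1
  field_simp

theorem mOf_crowds_initiator
    (hμ : ∀ p, μ p = ENNReal.ofReal (crowdsWeight c p.1 p.2 / (n * (n - c : ℕ))))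
    (i₀ o : Fin (n - c)) :
    mOf μ ({p | p.1 = i₀} ∩ Prod.snd ⁻¹' {o}) =
      ENNReal.ofReal (crowdsWeight c i₀ o / (n * (n - c : ℕ))) := by
  rw [mOf_eq_ofReal_sum μ _ (fun p => div_nonneg (crowdsWeight_pos c _ _).le (by positivity)) hμ,
    Fintype.sum_prod_type]
  simp [ite_and]

theorem mOf_crowds_initiator_compl (hn : c + 2 ≤ n)
    (hμ : ∀ p, μ p = ENNReal.ofReal (crowdsWeight c p.1 p.2 / (n * (n - c : ℕ))))
    (i₀ o : Fin (n - c)) :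
    mOf μ ({p | p.1 = i₀}ᶜ ∩ Prod.snd ⁻¹' {o}) =
      ENNReal.ofReal ((n - crowdsWeight c i₀ o) / (n * (n - c : ℕ))) := by
  rw [mOf_eq_ofReal_sum μ _ (fun p => div_nonneg (crowdsWeight_pos c _ _).le (by positivity)) hμ,
    Fintype.sum_prod_type]
  simp only [Set.mem_inter_iff, Set.mem_compl_iff, Set.mem_ofPred_eq, Set.mem_preimage,
    Set.mem_singleton_iff]
  have h : ∀ i : Fin (n - c), (∑ j, if ¬ i = i₀ ∧ j = o then
      crowdsWeight c i j / ((n : ℝ) * (n - c : ℕ)) else 0) =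
      crowdsWeight c i o / (n * (n - c : ℕ)) -
        if i = i₀ then crowdsWeight c i o / (n * (n - c : ℕ)) else 0 := by
    intro i
    by_cases hi : i = i₀ <;> simp [hi]
  simp only [h, Finset.sum_sub_distrib, Finset.sum_ite_eq', Finset.mem_univ, if_true]
  rw [← Finset.sum_div, sum_crowdsWeight (by omega), sub_div]

theorem Vul_crowds (hn : c + 2 ≤ n)
    (hμ : ∀ p, μ p = ENNReal.ofReal (crowdsWeight c p.1 p.2 / (n * (n - c : ℕ))))
    (i₀ o : Fin (n - c)) :
    Vul μ {p | p.1 = i₀} Prod.snd o =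
      ENNReal.ofReal (1 - min (crowdsWeight c i₀ o) (n - crowdsWeight c i₀ o) / n) := by
  have h₁ : (0 : ℝ) < n := by exact_mod_cast (by omega : 0 < n)
  have h₂ : (0 : ℝ) < (n - c : ℕ) := by exact_mod_cast (by omega : 0 < n - c)
  rw [Vul, mOf_crowds_fibre hn hμ, mOf_crowds_initiator hμ, mOf_crowds_initiator_compl hn hμ,
    ← ENNReal.ofReal_max, ← ENNReal.ofReal_div_of_pos (by positivity),
    max_div_div_right (by positivity)]
  congr 1
  rcases le_total (crowdsWeight c i₀ o) (n - crowdsWeight c i₀ o) with h | h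
  · rw [max_eq_right h, min_eq_left h]
    field_simp
  · rw [max_eq_left h, min_eq_right h]
    field_simp
    ring

theorem RPSO_crowds (hn : c + 2 ≤ n)
    (hμ : ∀ p, μ p = ENNReal.ofReal (crowdsWeight c p.1 p.2 / (n * (n - c : ℕ))))
    (i₀ : Fin (n - c)) :
    RPSO μ {p | p.1 = i₀} Prod.snd =
      ENNReal.ofReal
        (1 / (Real.logb 2 n - Real.logb 2 (min (c + 1 : ℝ) (n - c - 1)) / (n - c))) := by
  have hc : (0 : ℝ) ≤ c := c.cast_nonneg
  have hnc : (c : ℝ) + 2 ≤ n := by exact_mod_cast hn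
  have h₁ : (0 : ℝ) < n := by linarith
  have hcast : ((n - c : ℕ) : ℝ) = n - c := Nat.cast_sub (by omega)
  have h₂ : (0 : ℝ) < n - c := by linarith
  set m : Fin (n - c) → ℝ := fun o =>
    min (crowdsWeight c i₀ o) (n - crowdsWeight c i₀ o) with hm
  have hm_one : ∀ o, 1 ≤ m o := by
    intro o
    simp only [hm, crowdsWeight]
    split_ifs <;> refine le_min ?_ ?_ <;> linarith
  have hm_lt : ∀ o, m o < n := fun o =>
    (min_le_right _ _).trans_lt (sub_lt_self _ (crowdsWeight_pos c _ _))
  have hlog : ∀ o, 0 ≤ Real.logb 2 n - Real.logb 2 (m o) := fun o =>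
    sub_nonneg.2 (Real.logb_le_logb_of_le one_lt_two (by linarith [hm_one o]) (hm_lt o).le)
  have hterm : ∀ o, mOf μ (Prod.snd ⁻¹' {o}) *
      (if Vul μ {p | p.1 = i₀} Prod.snd o = 1 then ⊤
       else ENNReal.ofReal (- Real.logb 2 ((1 - Vul μ {p | p.1 = i₀} Prod.snd o).toReal))) =
      ENNReal.ofReal (1 / (n - c) * (Real.logb 2 n - Real.logb 2 (m o))) := by
    intro o
    have hpos : 0 < m o := by linarith [hm_one o]
    have hq : 0 < m o / n := by positivity
    have hq1 : m o / n < 1 := (div_lt_one h₁).2 (hm_lt o)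
    have hV : Vul μ {p | p.1 = i₀} Prod.snd o = ENNReal.ofReal (1 - m o / n) :=
      Vul_crowds hn hμ i₀ o
    have hne : Vul μ {p | p.1 = i₀} Prod.snd o ≠ 1 := by
      rw [hV, Ne, ENNReal.ofReal_eq_one]
      linarith
    rw [if_neg hne, hV, ← ENNReal.ofReal_one, ← ENNReal.ofReal_sub _ (by linarith),
      sub_sub_cancel, ENNReal.toReal_ofReal hq.le, Real.logb_div hpos.ne' h₁.ne', neg_sub,
      mOf_crowds_fibre hn hμ, hcast, ← ENNReal.ofReal_mul (by positivity)]
  have hm_eq : ∀ o, Real.logb 2 (m o) =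
      if i₀ = o then Real.logb 2 (min (c + 1 : ℝ) (n - c - 1)) else 0 := by
    intro o
    simp only [hm, crowdsWeight]
    split_ifs
    · rw [sub_add_eq_sub_sub]
    · rw [min_eq_left (by linarith), Real.logb_one]
  have hsum : ∑ o, 1 / ((n : ℝ) - c) * (Real.logb 2 n - Real.logb 2 (m o)) =
      Real.logb 2 n - Real.logb 2 (min (c + 1 : ℝ) (n - c - 1)) / (n - c) := by
    simp only [hm_eq, ← Finset.mul_sum, Finset.sum_sub_distrib, Finset.sum_ite_eq,
      Finset.mem_univ, if_true, Finset.sum_const, Finset.card_univ, Fintype.card_fin,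
      nsmul_eq_mul, hcast]
    field_simp
  have hpos : 0 < ∑ o, 1 / ((n : ℝ) - c) * (Real.logb 2 n - Real.logb 2 (m o)) := by
    refine Finset.sum_pos (fun o _ => mul_pos (by positivity) ?_) ⟨i₀, Finset.mem_univ _⟩
    exact sub_pos.2 (Real.logb_lt_logb one_lt_two (by linarith [hm_one o]) (hm_lt o))
  rw [RPSO, tsum_fintype, Finset.sum_congr rfl fun o _ => hterm o,
    ← ENNReal.ofReal_sum_of_nonneg
      (fun o _ => mul_nonneg (by positivity) (hlog o)),
    ← ENNReal.ofReal_inv_of_pos hpos, hsum, one_div]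

end Crowds

/-- Section 6.3: for the Crowds protocol with n users among whom c are corrupt, the
restrictive probabilistic symmetric opacity of the predicate "user i₀ initiated the
request" with respect to the observation of the detected user equals
1/(log₂ n − log₂(n−c−1)/(n−c)) when n ≤ 2(c+1), and
1/(log₂ n − log₂(c+1)/(n−c)) when n > 2(c+1). -/
theorem crowds_rpso (n c : ℕ) (hn : c + 2 ≤ n)
    (i₀ : Fin (n - c)) (μ : PMF (Fin (n - c) × Fin (n - c)))
    (hμ : ∀ i j : Fin (n - c),
      μ (i, j) = (if i = j then ((c : ℝ≥0∞) + 1) else 1) /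
        ((n : ℝ≥0∞) * ((n - c : ℕ) : ℝ≥0∞))) :
    (n ≤ 2 * (c + 1) →
      RPSO μ {p : Fin (n - c) × Fin (n - c) | p.1 = i₀} Prod.snd =
        ENNReal.ofReal
          (1 / (Real.logb 2 n - Real.logb 2 ((n : ℝ) - c - 1) / ((n : ℝ) - c)))) ∧
    (2 * (c + 1) < n →
      RPSO μ {p : Fin (n - c) × Fin (n - c) | p.1 = i₀} Prod.snd =
        ENNReal.ofReal
          (1 / (Real.logb 2 n - Real.logb 2 ((c : ℝ) + 1) / ((n : ℝ) - c)))) := by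
  rw [RPSO_crowds hn (crowds_apply hn hμ) i₀]
  constructor <;> intro h
  · have h' : (n : ℝ) ≤ 2 * (c + 1) := by exact_mod_cast h
    rw [min_eq_right (by linarith)]
  · have h' : 2 * ((c : ℝ) + 1) < n := by exact_mod_cast h
    rw [min_eq_left (by linarith)]
end
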